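/- arXiv:2203.09347 — 2 statements merged into one kernel-verified Lean document; each statement's English description precedes it below -/
import Mathlib

section
/- Let $\rho_X$ be a probability measure on $\mathcal{X} \subseteq \mathbb{R}^D$, let $K(x_1, x_2) = \phi(|x_1 - x_2|)$ be a radial kernel, let $A \in \mathbb{R}^{d \times D}$ have orthonormal rows with inverse $A_{\rm inv} \in \mathbb{R}^{D \times d}$ having orthonormal columns satisfying $A_{\rm inv}(A x) = x$ on $\operatorname{supp}(\rho_X)$, and let $\tilde{\rho}_{\tilde{X}}$ be the pushforward of $\rho_X$ under $A$. Then for $\lambda > 0$ and $\varphi : \mathcal{X} \to \mathbb{R}$, the pair $(\lambda, \varphi)$ is an eigenvalue/eigenfunction pair of the kernel integral operator $L_{K, \rho_X}$ if and only if $(\lambda, \varphi \circ A_{\rm inv})$ is an eigenvalue/eigenfunction pair of $L_{K, \tilde{\rho}_{\tilde{X}}}$. -/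
open MeasureTheory
open scoped RealInnerProductSpace ENNReal

/-- The (topological) support of a measure. -/
def measureSupport {X : Type*} [TopologicalSpace X] [MeasurableSpace X]
    (μ : Measure X) : Set X :=
  {x | ∀ U ∈ nhds x, μ U ≠ 0}

/-- For a radial kernel `K(x₁,x₂) = φ(‖x₁-x₂‖)`, an orthonormal-row matrix
`A` invertible on the support of `ρ_X` (with inverse `Ainv` having orthonormal columns), and
`ρ̃_X̃ = A_*ρ_X`: for `λ > 0`, `(λ, φfun)` is an eigenvalue/eigenfunction pair of the kernel
integral operator `L_{K,ρ_X}` if and only if `(λ, φfun ∘ Ainv)` is an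
eigenvalue/eigenfunction pair of `L_{K,ρ̃_X̃}`. -/
theorem eigenpair_correspondence_under_orthonormal_reduction
    (D d : ℕ) (φ : ℝ → ℝ)
    (ρX : Measure (EuclideanSpace ℝ (Fin D))) [IsProbabilityMeasure ρX]
    (A : EuclideanSpace ℝ (Fin D) →L[ℝ] EuclideanSpace ℝ (Fin d))
    (Ainv : EuclideanSpace ℝ (Fin d) →L[ℝ] EuclideanSpace ℝ (Fin D))
    (hA : ∀ u : EuclideanSpace ℝ (Fin d), ‖(ContinuousLinearMap.adjoint A) u‖ = ‖u‖)
    (hAinv : ∀ u : EuclideanSpace ℝ (Fin d), ‖Ainv u‖ = ‖u‖)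
    (hinv : ∀ x ∈ measureSupport ρX, Ainv (A x) = x)
    (ρtX : Measure (EuclideanSpace ℝ (Fin d))) [IsProbabilityMeasure ρtX]
    (hρtX : ρtX = ρX.map A)
    (lam : ℝ) (hlam : 0 < lam)
    (φfun : EuclideanSpace ℝ (Fin D) → ℝ) (hφfun : Measurable φfun)
    (hφfun_ne : ¬ φfun =ᵐ[ρX] 0) :
    ((∀ᵐ x ∂ρX, (∫ u, φ ‖x - u‖ * φfun u ∂ρX) = lam * φfun x) ↔
     (∀ᵐ xt ∂ρtX,
       (∫ ut, φ ‖xt - ut‖ * φfun (Ainv ut) ∂ρtX) = lam * φfun (Ainv xt))) := by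
  have hsupp : ∀ᵐ x ∂ρX, x ∈ measureSupport ρX := by
    have h0 : ρX (measureSupport ρX)ᶜ = 0 := by
      refine measure_null_of_locally_null _ fun x hx => ?_
      simp only [measureSupport, Set.mem_compl_iff, Set.mem_setOf_eq, not_forall, not_not] at hx
      obtain ⟨U, hU, h0⟩ := hx
      exact ⟨U, mem_nhdsWithin_of_mem_nhds hU, h0⟩
    exact h0
  have hid : ∀ᵐ x ∂ρX, Ainv (A x) = x := hsupp.mono hinv
  have hiso : Isometry Ainv := AddMonoidHomClass.isometry_of_norm Ainv hAinv
  have hemb : MeasurableEmbedding Ainv := hiso.isClosedEmbedding.measurableEmbedding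
  have hmap : ρX = ρtX.map Ainv := by
    rw [hρtX, Measure.map_map Ainv.continuous.measurable A.continuous.measurable]
    have h : (Ainv ∘ A) =ᵐ[ρX] id := hid
    rw [Measure.map_congr h, Measure.map_id]
  have key : ∀ xt : EuclideanSpace ℝ (Fin d),
      (∫ u, φ ‖Ainv xt - u‖ * φfun u ∂ρX)
        = ∫ ut, φ ‖xt - ut‖ * φfun (Ainv ut) ∂ρtX := by
    intro xt
    rw [hmap, hemb.integral_map]
    simp only [← map_sub, hAinv]
  have h1 : (∀ᵐ x ∂ρX, (∫ u, φ ‖x - u‖ * φfun u ∂ρX) = lam * φfun x) ↔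
      ∀ᵐ xt ∂ρtX, (∫ u, φ ‖Ainv xt - u‖ * φfun u ∂ρX) = lam * φfun (Ainv xt) := by
    have := hemb.ae_map_iff (μ := ρtX)
      (p := fun x => (∫ u, φ ‖x - u‖ * φfun u ∂ρX) = lam * φfun x)
    rwa [← hmap] at this
  rw [h1]
  simp only [key]
end

section
/- Let $X \sim \rho_X$ be a sub-Gaussian, centered random vector in $\mathbb{R}^D$ whose covariance matrix has decreasing eigenvalues $\sigma_1^X \geq \cdots \geq \sigma_D^X$ with $\sigma_d^X - \sigma_{d+1}^X > 0$. Let $P$ be the rank-$d$ orthogonal projection minimizing $\int |x - \tilde{P} x|^2 \rho_X(dx)$ and $\hat{P}_n$ the rank-$d$ orthogonal projection minimizing $\frac{1}{n} \sum_{i=1}^n |X_i - \tilde{P} X_i|^2$ for an i.i.d. sample $X_1, \ldots, X_n \sim \rho_X$. Then there exists a constant $C_{pca}$ (independent of $n$ and $\eta$) such that for all $n \in \mathbb{N}$ and $\eta \in (0, 1)$, with probability at least $1 - \eta$, $\|\hat{P}_n - P\|_{op} \leq \|\hat{P}_n - P\|_2 \leq \frac{C_{pca}}{\eta \sqrt{n}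 (\sigma_{d+1}^X - \sigma_d^X)}$ (where the denominator is read as the absolute eigengap $\sigma_d^X - \sigma_{d+1}^X$). -/
open MeasureTheory
open scoped RealInnerProductSpace ENNReal

/-- A sub-Gaussian distribution on a Euclidean space: all one-dimensional marginals have
sub-Gaussian tails. -/
def IsSubGaussian {E : Type*} [NormedAddCommGroup E] [InnerProductSpace ℝ E]
    [MeasurableSpace E] (μ : Measure E) : Prop :=
  ∃ c : ℝ, 0 < c ∧ ∀ v : E, ‖v‖ = 1 → ∀ t : ℝ, 0 ≤ t →
    μ {x | t ≤ |⟪x, v⟫|} ≤ ENNReal.ofReal (2 * Real.exp (-(t ^ 2) / c ^ 2))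

/-- An orthogonal projection of rank `d`: idempotent, self-adjoint, with `d`-dimensional
range. -/
def IsOrthProjRank {E : Type*} [NormedAddCommGroup E] [InnerProductSpace ℝ E]
    (P : E →L[ℝ] E) (d : ℕ) : Prop :=
  P.comp P = P ∧ (∀ x y : E, ⟪P x, y⟫ = ⟪x, P y⟫) ∧
    Module.finrank ℝ (LinearMap.range (P : E →ₗ[ℝ] E)) = d

/-- The Hilbert–Schmidt norm of an operator on `ℝ^D`. -/
noncomputable def hsNorm {D : ℕ}
    (T : EuclideanSpace ℝ (Fin D) →L[ℝ] EuclideanSpace ℝ (Fin D)) : ℝ :=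
  Real.sqrt (∑ i, ‖T (EuclideanSpace.basisFun (Fin D) ℝ i)‖ ^ 2)

section helpers
open ProbabilityTheory

local notation "EE" D => EuclideanSpace ℝ (Fin D)

lemma pca_trace {D d : ℕ} (Q : (EE D) →L[ℝ] (EE D)) (hc : Q.comp Q = Q)
    (b : OrthonormalBasis (Fin D) ℝ (EE D)) :
    ∑ j, ⟪b j, Q (b j)⟫ = (Module.finrank ℝ (LinearMap.range (Q : (EE D) →ₗ[ℝ] (EE D))) : ℝ) := by
  have h1 : IsIdempotentElem (Q : (EE D) →ₗ[ℝ] (EE D)) := by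
    ext1 x
    exact congrArg (fun T => T x) hc
  have h2 := (LinearMap.IsIdempotentElem.isProj_range _ h1).trace
  rw [← h2, LinearMap.trace_eq_sum_inner _ b]
  rfl

lemma pca_quad {D : ℕ} (Q : (EE D) →L[ℝ] (EE D))
    (b : OrthonormalBasis (Fin D) ℝ (EE D)) (x : EE D) :
    ⟪x, Q x⟫ = ∑ j, ∑ k, (⟪x, b j⟫ * ⟪x, b k⟫) * ⟪b j, Q (b k)⟫ := by
  have h : Q x = ∑ k, ⟪x, b k⟫ • Q (b k) := by
    conv_lhs => rw [← b.sum_repr x]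
    simp [map_sum, b.repr_apply_apply, real_inner_comm]
  rw [← b.sum_inner_mul_inner x (Q x)]
  refine Finset.sum_congr rfl fun j _ => ?_
  rw [h, inner_sum, Finset.mul_sum]
  refine Finset.sum_congr rfl fun k _ => ?_
  rw [inner_smul_right]; ring

lemma pca_hs {D : ℕ} (T : (EE D) →L[ℝ] (EE D)) (hT : ∀ x y, ⟪T x, y⟫ = ⟪x, T y⟫)
    (b : OrthonormalBasis (Fin D) ℝ (EE D)) :
    ∑ i, ‖T (EuclideanSpace.basisFun (Fin D) ℝ i)‖ ^ 2 = ∑ j, ‖T (b j)‖ ^ 2 := by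
  set e := EuclideanSpace.basisFun (Fin D) ℝ
  calc _ = ∑ i, ∑ j, ⟪b j, T (e i)⟫ ^ 2 := by
        refine Finset.sum_congr rfl fun i _ => ?_
        rw [← b.sum_sq_norm_inner_right (T (e i))]
        simp
    _ = ∑ j, ∑ i, ⟪e i, T (b j)⟫ ^ 2 := by
        rw [Finset.sum_comm]
        refine Finset.sum_congr rfl fun j _ => Finset.sum_congr rfl fun i _ => ?_
        rw [← hT, real_inner_comm]
    _ = _ := by
        refine Finset.sum_congr rfl fun i _ => ?_
        rw [← e.sum_sq_norm_inner_right (T (b i))]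
        simp

lemma pca_op_le {D : ℕ} (T : (EE D) →L[ℝ] (EE D)) : ‖T‖ ≤ hsNorm T := by
  refine T.opNorm_le_bound (Real.sqrt_nonneg _) fun x => ?_
  set e := EuclideanSpace.basisFun (Fin D) ℝ with he
  have h : T x = ∑ k, ⟪e k, x⟫ • T (e k) := by
    conv_lhs => rw [← e.sum_repr x]
    simp only [map_sum, e.repr_apply_apply, map_smul]
  have hx : ‖x‖ = Real.sqrt (∑ k, ‖⟪e k, x⟫‖ ^ 2) := by
    rw [e.sum_sq_norm_inner_right, Real.sqrt_sq (norm_nonneg _)]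
  calc ‖T x‖ ≤ ∑ k, ‖T (e k)‖ * ‖⟪e k, x⟫‖ := by
        rw [h]
        refine (norm_sum_le _ _).trans (le_of_eq ?_)
        refine Finset.sum_congr rfl fun k _ => ?_
        rw [norm_smul, mul_comm]
    _ ≤ _ := by
        rw [hx]
        exact Real.sum_mul_le_sqrt_mul_sqrt _ _ _

lemma pca_inner_proj {D d : ℕ} {Q : (EE D) →L[ℝ] (EE D)} (hQ : IsOrthProjRank Q d) (x : EE D) :
    ⟪x, Q x⟫ = ‖Q x‖ ^ 2 := by
  have h : Q (Q x) = Q x := congrArg (fun T => T x) hQ.1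
  rw [← real_inner_self_eq_norm_sq, hQ.2.1, h]

lemma pca_resid {D d : ℕ} {Q : (EE D) →L[ℝ] (EE D)} (hQ : IsOrthProjRank Q d) (x : EE D) :
    ‖x - Q x‖ ^ 2 = ‖x‖ ^ 2 - ⟪x, Q x⟫ := by
  rw [norm_sub_sq_real, pca_inner_proj hQ]; ring

lemma pca_inner_le {D d : ℕ} {Q : (EE D) →L[ℝ] (EE D)} (hQ : IsOrthProjRank Q d) (x : EE D) :
    ⟪x, Q x⟫ ≤ ‖x‖ ^ 2 := by
  have := pca_resid hQ x
  nlinarith [sq_nonneg ‖x - Q x‖]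

/-- the projection on the first `d` vectors -/
noncomputable def pcaP0 {D : ℕ} (d : ℕ) (b : OrthonormalBasis (Fin D) ℝ (EE D)) :
    (EE D) →L[ℝ] (EE D) :=
  ∑ j : Fin D, (if (j : ℕ) < d then (1:ℝ) else 0) • ((innerSL ℝ (b j)).smulRight (b j))

lemma pcaP0_apply {D : ℕ} (d : ℕ) (b : OrthonormalBasis (Fin D) ℝ (EE D)) (x : EE D) :
    pcaP0 d b x = ∑ j : Fin D, (if (j : ℕ) < d then (1:ℝ) else 0) • ⟪b j, x⟫ • b j := by
  rw [pcaP0, sum_apply]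
  rfl

lemma pcaP0_basis {D : ℕ} (d : ℕ) (b : OrthonormalBasis (Fin D) ℝ (EE D)) (k : Fin D) :
    pcaP0 d b (b k) = (if (k : ℕ) < d then (1:ℝ) else 0) • b k := by
  rw [pcaP0_apply, Finset.sum_eq_single k]
  · simp
  · intro j _ hj
    rw [b.inner_eq_zero hj]; simp
  · simp

lemma pcaP0_proj {D : ℕ} (d : ℕ) (hdD : d < D) (b : OrthonormalBasis (Fin D) ℝ (EE D)) :
    IsOrthProjRank (pcaP0 d b) d := by
  have hc : (pcaP0 d b).comp (pcaP0 d b) = pcaP0 d b := by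
    ext1 x
    rw [ContinuousLinearMap.comp_apply]
    conv_lhs => rw [pcaP0_apply d b x]
    conv_rhs => rw [pcaP0_apply d b x]
    rw [map_sum]
    refine Finset.sum_congr rfl fun k _ => ?_
    rw [map_smul, map_smul, pcaP0_basis]
    split_ifs <;> simp
  refine ⟨hc, fun x y => ?_, ?_⟩
  · rw [pcaP0_apply, pcaP0_apply, sum_inner, inner_sum]
    refine Finset.sum_congr rfl fun k _ => ?_
    simp only [inner_smul_left, inner_smul_right, real_inner_comm (b k) x]
    simp only [mul_comm]
    try simp
  · have h := pca_trace (d := d) _ hc b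
    have h2 : ∑ j, ⟪b j, pcaP0 d b (b j)⟫ = (d : ℝ) := by
      simp only [pcaP0_basis, inner_smul_right, real_inner_self_eq_norm_sq, b.norm_eq_one]
      simp [Finset.sum_boole]
      rw [← Finset.card_map Fin.valEmbedding]
      conv_rhs => rw [← Finset.card_range d]
      congr 1
      ext a
      simp
      constructor
      · rintro ⟨i, hi, rfl⟩; exact hi
      · intro h; exact ⟨⟨a, by omega⟩, h, rfl⟩
    rw [h2] at h
    exact_mod_cast h.symm

lemma pca_curv {D d : ℕ} (hd : 0 < d) (hdD : d < D) (hd1 : d - 1 < D) (σ : Fin D → ℝ) (hσ : Antitone σ)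
    (b : OrthonormalBasis (Fin D) ℝ (EE D)) {Q : (EE D) →L[ℝ] (EE D)} (hQ : IsOrthProjRank Q d) :
    (σ ⟨d - 1, hd1⟩ - σ ⟨d, hdD⟩) / 2 * ∑ j, ‖(Q - pcaP0 d b) (b j)‖ ^ 2 ≤
      ∑ j, σ j * ⟪b j, pcaP0 d b (b j)⟫ - ∑ j, σ j * ⟪b j, Q (b j)⟫ := by
  have t1 := pca_trace (d := d) _ (pcaP0_proj d hdD b).1 b
  have t2 := pca_trace (d := d) _ hQ.1 b
  rw [(pcaP0_proj d hdD b).2.2] at t1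
  rw [hQ.2.2] at t2
  set m := (σ ⟨d - 1, hd1⟩ + σ ⟨d, hdD⟩) / 2 with hm
  have : ∑ j, σ j * ⟪b j, pcaP0 d b (b j)⟫ - ∑ j, σ j * ⟪b j, Q (b j)⟫ =
      ∑ j, (σ j - m) * (⟪b j, pcaP0 d b (b j)⟫ - ⟪b j, Q (b j)⟫) := by
    simp only [sub_mul, mul_sub, Finset.sum_sub_distrib, ← Finset.mul_sum, t1, t2]
    ring
  rw [this, Finset.mul_sum]
  refine Finset.sum_le_sum fun j _ => ?_
  have hq0 : 0 ≤ ⟪b j, Q (b j)⟫ := by rw [pca_inner_proj hQ]; positivity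
  have hq1 : ⟪b j, Q (b j)⟫ ≤ 1 := by simpa using pca_inner_le hQ (b j)
  have hn : ‖(Q - pcaP0 d b) (b j)‖ ^ 2 = if (j : ℕ) < d then 1 - ⟪b j, Q (b j)⟫
      else ⟪b j, Q (b j)⟫ := by
    rw [sub_apply, norm_sub_sq_real, pcaP0_basis, ← pca_inner_proj hQ,
      inner_smul_right, real_inner_comm]
    split_ifs <;> simp
    ring
  rw [hn, pcaP0_basis]
  have hjj : ⟪b j, b j⟫ = 1 := by simp
  split_ifs with hj
  · have := hσ (show j ≤ ⟨d - 1, hd1⟩ from Fin.mk_le_mk.2 (by omega))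
    rw [one_smul, hjj]
    refine mul_le_mul_of_nonneg_right ?_ (by linarith)
    rw [hm]; linarith
  · have := hσ (show ⟨d, hdD⟩ ≤ j from Fin.mk_le_mk.2 (by omega))
    rw [zero_smul, inner_zero_right]
    nlinarith

lemma pca_memLp_unit {D : ℕ} (ρX : Measure (EE D)) [IsProbabilityMeasure ρX]
    (hsub : IsSubGaussian ρX) (v : EE D) (hv : ‖v‖ = 1) : MemLp (fun x => ⟪x, v⟫) 4 ρX := by
  obtain ⟨c, hc, h⟩ := hsub
  refine ⟨by fun_prop, ?_⟩
  rw [eLpNorm_lt_top_iff_lintegral_rpow_enorm_lt_top (by norm_num) (by norm_num)]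
  have e : ∀ x : (EE D), ‖⟪x, v⟫‖ₑ ^ (ENNReal.toReal 4) = ENNReal.ofReal (|⟪x, v⟫| ^ (4:ℝ)) := by
    intro x
    rw [← ENNReal.ofReal_rpow_of_nonneg (abs_nonneg _) (by norm_num), Real.enorm_eq_ofReal_abs]
    norm_num
  simp only [e]
  rw [lintegral_rpow_eq_lintegral_meas_le_mul _ (Filter.Eventually.of_forall fun x => abs_nonneg _)
    (by fun_prop) (by norm_num)]
  refine ENNReal.mul_lt_top ENNReal.ofReal_lt_top ?_
  have hint : IntegrableOn (fun t : ℝ => 2 * (t ^ (3:ℝ) * Real.exp (-(1 / c ^ 2) * t ^ 2)))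
      (Set.Ioi 0) :=
    ((integrable_rpow_mul_exp_neg_mul_sq (by positivity) (by norm_num)).const_mul 2).integrableOn
  refine lt_of_le_of_lt ?_ hint.lintegral_lt_top
  refine setLIntegral_mono_ae' measurableSet_Ioi (Filter.Eventually.of_forall fun t ht => ?_)
  have ht' : (0:ℝ) ≤ t := le_of_lt ht
  refine (mul_le_mul_left (h v hv t ht') _).trans (le_of_eq ?_)
  rw [← ENNReal.ofReal_mul (by positivity)]
  congr 1
  have : (4:ℝ) - 1 = 3 := by norm_num
  rw [this, show -(t ^ 2) / c ^ 2 = -(1 / c ^ 2) * t ^ 2 by ring]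
  ring

lemma pca_memLp_mul {D : ℕ} (ρX : Measure (EE D)) [IsProbabilityMeasure ρX]
    (hsub : IsSubGaussian ρX) (v w : EE D) (hv : ‖v‖ = 1) (hw : ‖w‖ = 1) :
    MemLp (fun x => ⟪x, v⟫ * ⟪x, w⟫) 2 ρX := by
  have : ENNReal.HolderTriple 4 4 2 := ⟨by
    have : (4:ℝ≥0∞) = 2 * 2 := by norm_num
    rw [this, ENNReal.mul_inv (by simp) (by simp), ← mul_add, ENNReal.inv_two_add_inv_two, mul_one]⟩
  exact (pca_memLp_unit ρX hsub w hw).mul' (pca_memLp_unit ρX hsub v hv)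

lemma pca_cov {D : ℕ} (ρX : Measure (EE D)) [IsProbabilityMeasure ρX]
    (hsub : IsSubGaussian ρX) (σ : Fin D → ℝ)
    (b : OrthonormalBasis (Fin D) ℝ (EE D))
    (heig : ∀ i, (∫ x, ⟪x, b i⟫ • x ∂ρX) = σ i • b i) (j k : Fin D) :
    ∫ x, ⟪x, b j⟫ * ⟪x, b k⟫ ∂ρX = if j = k then σ j else 0 := by
  have hint : Integrable (fun x => ⟪x, b j⟫ • x) ρX := by
    have : (fun x : (EE D) => ⟪x, b j⟫ • x) = fun x => ∑ k, (⟪x, b j⟫ * ⟪x, b k⟫) • b k := by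
      ext1 x
      conv_lhs => rw [← b.sum_repr x]
      rw [Finset.smul_sum]
      rw [b.sum_repr]
      refine Finset.sum_congr rfl fun k _ => ?_
      rw [smul_smul, b.repr_apply_apply, real_inner_comm (b k)]
    rw [this]
    refine integrable_finsetSum _ fun k _ => Integrable.smul_const ?_ _
    exact (pca_memLp_mul ρX hsub _ _ (b.norm_eq_one j) (b.norm_eq_one k)).integrable (by norm_num)
  have h := integral_inner (𝕜 := ℝ) hint (b k)
  rw [heig j] at h
  have e : ∀ x : (EE D), ⟪b k, ⟪x, b j⟫ • x⟫ = ⟪x, b j⟫ * ⟪x, b k⟫ := by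
    intro x
    rw [inner_smul_right, real_inner_comm (b k)]
  simp only [e] at h
  rw [h, inner_smul_right, b.inner_eq_ite]
  by_cases hjk : j = k
  · rw [if_pos hjk.symm, if_pos hjk, mul_one]
  · rw [if_neg (fun h => hjk h.symm), if_neg hjk, mul_zero]

lemma pca_pop {D : ℕ} (ρX : Measure (EE D)) [IsProbabilityMeasure ρX]
    (hsub : IsSubGaussian ρX) (σ : Fin D → ℝ)
    (b : OrthonormalBasis (Fin D) ℝ (EE D))
    (heig : ∀ i, (∫ x, ⟪x, b i⟫ • x ∂ρX) = σ i • b i) (Q : (EE D) →L[ℝ] (EE D)) :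
    Integrable (fun x => ⟪x, Q x⟫) ρX ∧
    ∫ x, ⟪x, Q x⟫ ∂ρX = ∑ j, σ j * ⟪b j, Q (b j)⟫ := by
  have hi : ∀ j k, Integrable (fun x => (⟪x, b j⟫ * ⟪x, b k⟫) * ⟪b j, Q (b k)⟫) ρX := fun j k =>
    ((pca_memLp_mul ρX hsub _ _ (b.norm_eq_one j) (b.norm_eq_one k)).integrable
      (by norm_num)).mul_const _
  rw [show (fun x => ⟪x, Q x⟫) = fun x => ∑ j, ∑ k, (⟪x, b j⟫ * ⟪x, b k⟫) * ⟪b j, Q (b k)⟫ from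
    funext fun x => pca_quad Q b x]
  refine ⟨integrable_finsetSum _ fun j _ => integrable_finsetSum _ fun k _ => hi j k, ?_⟩
  rw [integral_finsetSum _ fun j _ => integrable_finsetSum _ fun k _ => hi j k]
  refine Finset.sum_congr rfl fun j _ => ?_
  rw [integral_finsetSum _ fun k _ => hi j k]
  simp only [integral_mul_const, pca_cov ρX hsub σ b heig]
  simp

lemma pca_eq {D d : ℕ} (hd : 0 < d) (hdD : d < D) (hd1 : d - 1 < D)
    (ρX : Measure (EE D)) [IsProbabilityMeasure ρX]
    (hsub : IsSubGaussian ρX) (σ : Fin D → ℝ) (hσ : Antitone σ)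
    (b : OrthonormalBasis (Fin D) ℝ (EE D))
    (heig : ∀ i, (∫ x, ⟪x, b i⟫ • x ∂ρX) = σ i • b i)
    (hgap : 0 < σ ⟨d - 1, hd1⟩ - σ ⟨d, hdD⟩)
    (P : (EE D) →L[ℝ] (EE D)) (hP : IsOrthProjRank P d)
    (hPopt : ∀ Q, IsOrthProjRank Q d →
      (∫ x, ‖x - P x‖ ^ 2 ∂ρX) ≤ ∫ x, ‖x - Q x‖ ^ 2 ∂ρX) : P = pcaP0 d b := by
  have h := hPopt _ (pcaP0_proj d hdD b)
  simp only [pca_resid hP, pca_resid (pcaP0_proj d hdD b)] at h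
  have hn : Integrable (fun x => ‖x‖ ^ 2) ρX := by
    simpa using (pca_pop ρX hsub σ b heig (ContinuousLinearMap.id ℝ _)).1
  obtain ⟨i1, e1⟩ := pca_pop ρX hsub σ b heig P
  obtain ⟨i2, e2⟩ := pca_pop ρX hsub σ b heig (pcaP0 d b)
  rw [integral_sub hn i1, integral_sub hn i2, e1, e2] at h
  have hcv := pca_curv hd hdD hd1 σ hσ b hP
  have hs : ∑ j, ‖(P - pcaP0 d b) (b j)‖ ^ 2 ≤ 0 := by
    by_contra hcon
    push Not at hcon
    have := mul_pos (half_pos hgap) hcon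
    linarith
  have hz := (Finset.sum_eq_zero_iff_of_nonneg (fun j _ => by positivity)).1
    (le_antisymm hs (Finset.sum_nonneg fun j _ => by positivity))
  have : (P : (EE D) →ₗ[ℝ] (EE D)) = (pcaP0 d b : (EE D) →ₗ[ℝ] (EE D)) := by
    refine b.toBasis.ext fun j => ?_
    have := hz j (Finset.mem_univ _)
    simp only [ne_eq, OfNat.ofNat_ne_zero, not_false_eq_true, pow_eq_zero_iff, norm_eq_zero,
      sub_apply, sub_eq_zero] at this
    simpa using this
  exact ContinuousLinearMap.coe_injective this

/-- empirical covariance error entries -/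
noncomputable def pcaDel {D : ℕ} (n : ℕ) (σ : Fin D → ℝ) (b : OrthonormalBasis (Fin D) ℝ (EE D))
    (j k : Fin D) (ω : Fin n → EE D) : ℝ :=
  (1 / (n : ℝ)) * ∑ i, ⟪ω i, b j⟫ * ⟪ω i, b k⟫ - if j = k then σ j else 0

lemma pca_det {D d : ℕ} (hd : 0 < d) (hdD : d < D) (hd1 : d - 1 < D)
    (σ : Fin D → ℝ) (hσ : Antitone σ)
    (b : OrthonormalBasis (Fin D) ℝ (EE D))
    (hgap : 0 < σ ⟨d - 1, hd1⟩ - σ ⟨d, hdD⟩)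
    (n : ℕ) (ω : Fin n → EE D)
    (Q : (EE D) →L[ℝ] (EE D)) (hQ : IsOrthProjRank Q d)
    (hopt : (1 / (n : ℝ)) * ∑ i, ‖ω i - Q (ω i)‖ ^ 2 ≤
              (1 / (n : ℝ)) * ∑ i, ‖ω i - pcaP0 d b (ω i)‖ ^ 2) :
    hsNorm (Q - pcaP0 d b) ≤ 2 * Real.sqrt (∑ j, ∑ k, pcaDel n σ b j k ω ^ 2) /
      (σ ⟨d - 1, hd1⟩ - σ ⟨d, hdD⟩) := by
  have hP0 := pcaP0_proj d hdD b
  set g := σ ⟨d - 1, hd1⟩ - σ ⟨d, hdD⟩ with hg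
  set T := Q - pcaP0 d b with hT
  have hsym : ∀ x y, ⟪T x, y⟫ = ⟪x, T y⟫ := by
    intro x y
    simp [hT, inner_sub_left, inner_sub_right, hQ.2.1, hP0.2.1]
  have hh : hsNorm T = Real.sqrt (∑ j, ∑ k, ⟪b j, T (b k)⟫ ^ 2) := by
    rw [hsNorm, pca_hs T hsym b, Finset.sum_comm]
    congr 1
    refine Finset.sum_congr rfl fun i _ => ?_
    rw [← b.sum_sq_norm_inner_right (T (b i))]
    simp
  have hh2 : hsNorm T ^ 2 = ∑ j, ‖T (b j)‖ ^ 2 := by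
    rw [hsNorm, pca_hs T hsym b, Real.sq_sqrt (Finset.sum_nonneg fun j _ => by positivity)]
  have hcv := pca_curv hd hdD hd1 σ hσ b hQ
  rw [← hT, ← hh2, ← hg] at hcv
  have hemp : 0 ≤ (1 / (n : ℝ)) * ∑ i, ⟪ω i, T (ω i)⟫ := by
    simp only [pca_resid hQ, pca_resid hP0, Finset.sum_sub_distrib, mul_sub] at hopt
    simp only [hT, sub_apply, inner_sub_right, Finset.sum_sub_distrib, mul_sub]
    linarith
  have hkey : ∑ j, ∑ k, pcaDel n σ b j k ω * ⟪b j, T (b k)⟫ =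
      (1 / (n : ℝ)) * ∑ i, ⟪ω i, T (ω i)⟫ +
       (∑ j, σ j * ⟪b j, pcaP0 d b (b j)⟫ - ∑ j, σ j * ⟪b j, Q (b j)⟫) := by
    have h1 : ∑ i, ⟪ω i, T (ω i)⟫ =
        ∑ j, ∑ k, (∑ i, ⟪ω i, b j⟫ * ⟪ω i, b k⟫) * ⟪b j, T (b k)⟫ := by
      simp only [pca_quad T b]
      rw [Finset.sum_comm]
      refine Finset.sum_congr rfl fun j _ => ?_
      rw [Finset.sum_comm]
      simp only [Finset.sum_mul]
    have h2 : ∑ j, σ j * ⟪b j, pcaP0 d b (b j)⟫ - ∑ j, σ j * ⟪b j, Q (b j)⟫ =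
        - ∑ j, ∑ k, (if j = k then σ j else 0) * ⟪b j, T (b k)⟫ := by
      simp [hT, inner_sub_right, mul_sub]
    rw [h1, h2, ← sub_eq_add_neg, Finset.mul_sum, ← Finset.sum_sub_distrib]
    refine Finset.sum_congr rfl fun j _ => ?_
    rw [Finset.mul_sum, ← Finset.sum_sub_distrib]
    refine Finset.sum_congr rfl fun k _ => ?_
    rw [pcaDel]; ring
  have hcs : ∑ j, ∑ k, pcaDel n σ b j k ω * ⟪b j, T (b k)⟫ ≤
      Real.sqrt (∑ j, ∑ k, pcaDel n σ b j k ω ^ 2) * hsNorm T := by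
    rw [hh]
    simp only [← Fintype.sum_prod_type']
    exact Real.sum_mul_le_sqrt_mul_sqrt _ _ _
  rw [le_div_iff₀ hgap]
  have h0 : 0 ≤ hsNorm T := Real.sqrt_nonneg _
  rcases h0.eq_or_lt with h0 | h0
  · rw [← h0]; simp
  · have : hsNorm T * (hsNorm T * g) ≤
      hsNorm T * (2 * Real.sqrt (∑ j, ∑ k, pcaDel n σ b j k ω ^ 2)) := by nlinarith
    exact le_of_mul_le_mul_left this h0

lemma pca_var {D : ℕ} (ρX : Measure (EE D)) [IsProbabilityMeasure ρX]
    (hsub : IsSubGaussian ρX) (σ : Fin D → ℝ)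
    (b : OrthonormalBasis (Fin D) ℝ (EE D))
    (heig : ∀ i, (∫ x, ⟪x, b i⟫ • x ∂ρX) = σ i • b i) (j k : Fin D) (n : ℕ) (hn : 0 < n) :
    Integrable (fun ω => pcaDel n σ b j k ω ^ 2) (Measure.pi fun _ : Fin n => ρX) ∧
    ∫ ω, pcaDel n σ b j k ω ^ 2 ∂(Measure.pi fun _ : Fin n => ρX) ≤
      (∫ x, (⟪x, b j⟫ * ⟪x, b k⟫) ^ 2 ∂ρX) / n := by
  have hf := pca_memLp_mul ρX hsub _ _ (b.norm_eq_one j) (b.norm_eq_one k)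
  have hcov := pca_cov ρX hsub σ b heig j k
  set f : (EE D) → ℝ := fun x => ⟪x, b j⟫ * ⟪x, b k⟫ with hfdef
  set μ := Measure.pi fun _ : Fin n => ρX with hμ
  have hn' : (n : ℝ) ≠ 0 := by positivity
  have hfi : ∀ i : Fin n, MemLp (fun ω : Fin n → (EE D) => f (ω i)) 2 μ := fun i =>
    hf.comp_measurePreserving (measurePreserving_eval (fun _ : Fin n => ρX) i)
  have hS : MemLp (fun ω : Fin n → (EE D) => (1 / (n : ℝ)) * ∑ i, f (ω i)) 2 μ :=
    (memLp_finsetSum _ fun i _ => hfi i).const_mul _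
  have hmean : ∫ ω, (1 / (n : ℝ)) * ∑ i, f (ω i) ∂μ = if j = k then σ j else 0 := by
    rw [integral_const_mul, integral_finsetSum _ fun i _ => (hfi i).integrable (by norm_num)]
    have : ∀ i : Fin n, ∫ ω, f (ω i) ∂μ = if j = k then σ j else 0 := by
      intro i
      rw [← hcov]
      exact integral_comp_eval (μ := fun _ : Fin n => ρX) (i := i) hf.aestronglyMeasurable
    simp only [this, Finset.sum_const, Finset.card_univ, Fintype.card_fin, nsmul_eq_mul]
    rw [← mul_assoc, one_div, inv_mul_cancel₀ hn', one_mul]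
  have hvar : variance (fun ω : Fin n → (EE D) => (1 / (n : ℝ)) * ∑ i, f (ω i)) μ =
      variance f ρX / n := by
    rw [variance_const_mul]
    have := variance_sum_pi (μ := fun _ : Fin n => ρX) (X := fun _ => f) (fun _ => hf)
    have e : (∑ i : Fin n, fun ω : Fin n → (EE D) => f (ω i)) = fun ω => ∑ i, f (ω i) := by
      ext1 ω; simp
    rw [e] at this
    rw [this]
    simp
    field_simp
  refine ⟨(hS.sub (memLp_const _)).integrable_sq, ?_⟩
  have h1 : ∫ ω, pcaDel n σ b j k ω ^ 2 ∂μ = variance f ρX / n := by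
    rw [← hvar, variance_eq_integral hS.aestronglyMeasurable.aemeasurable, hmean]
    rfl
  rw [h1]
  gcongr
  exact variance_le_expectation_sq hf.aestronglyMeasurable

end helpers

/-- **PCA estimation error.** Let `X ∼ ρ_X` be a centered sub-Gaussian vector
in `ℝ^D` whose covariance has decreasing eigenvalues `σ₁ ≥ … ≥ σ_D` with eigengap
`σ_d - σ_{d+1} > 0`. Let `P` be the rank-`d` orthogonal projection minimizing the population
reconstruction error and `P̂ₙ` its empirical counterpart from an i.i.d. sample. Then there is
a constant `C_pca` (independent of `n` and `η`) such that for all `n` and `η ∈ (0,1)`, with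
probability at least `1 - η`,
`‖P̂ₙ - P‖_op ≤ ‖P̂ₙ - P‖₂ ≤ C_pca / (η √n (σ_d - σ_{d+1}))`. -/
theorem pca_projection_estimation_error
    (D d : ℕ) (hd : 0 < d) (hdD : d < D)
    (ρX : Measure (EuclideanSpace ℝ (Fin D))) [IsProbabilityMeasure ρX]
    (hsub : IsSubGaussian ρX)
    (hcent : (∫ x, x ∂ρX) = 0)
    -- covariance eigenvalues in decreasing order, with orthonormal eigenbasis
    (σ : Fin D → ℝ) (hσ : Antitone σ)
    (b : OrthonormalBasis (Fin D) ℝ (EuclideanSpace ℝ (Fin D)))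
    (heig : ∀ i, (∫ x, ⟪x, b i⟫ • x ∂ρX) = σ i • b i)
    (hgap : 0 < σ ⟨d - 1, by omega⟩ - σ ⟨d, hdD⟩)
    -- `P` minimizes the population reconstruction error among rank-`d` projections
    (P : EuclideanSpace ℝ (Fin D) →L[ℝ] EuclideanSpace ℝ (Fin D))
    (hP : IsOrthProjRank P d)
    (hPopt : ∀ Q, IsOrthProjRank Q d →
      (∫ x, ‖x - P x‖ ^ 2 ∂ρX) ≤ ∫ x, ‖x - Q x‖ ^ 2 ∂ρX) :
    ∃ Cpca : ℝ, 0 < Cpca ∧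
      ∀ n : ℕ, 0 < n → ∀ η : ℝ, η ∈ Set.Ioo (0 : ℝ) 1 →
        ∀ Phat : (Fin n → EuclideanSpace ℝ (Fin D)) →
            (EuclideanSpace ℝ (Fin D) →L[ℝ] EuclideanSpace ℝ (Fin D)),
          (∀ ω, IsOrthProjRank (Phat ω) d ∧
            ∀ Q, IsOrthProjRank Q d →
              (1 / (n : ℝ)) * ∑ i, ‖ω i - Phat ω (ω i)‖ ^ 2 ≤
              (1 / (n : ℝ)) * ∑ i, ‖ω i - Q (ω i)‖ ^ 2) →
          1 - ENNReal.ofReal η ≤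
            (Measure.pi fun _ : Fin n => ρX)
              {ω | ‖Phat ω - P‖ ≤ hsNorm (Phat ω - P) ∧
                   hsNorm (Phat ω - P) ≤
                     Cpca / (η * Real.sqrt n * (σ ⟨d - 1, by omega⟩ - σ ⟨d, hdD⟩))} := by
  obtain rfl := pca_eq hd hdD (by omega) ρX hsub σ hσ b heig hgap P hP hPopt
  set V : ℝ := ∑ j, ∑ k, ∫ x, (⟪x, b j⟫ * ⟪x, b k⟫) ^ 2 ∂ρX with hV
  have hV0 : 0 ≤ V := Finset.sum_nonneg fun j _ => Finset.sum_nonneg fun k _ =>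
    integral_nonneg fun x => sq_nonneg _
  refine ⟨2 * Real.sqrt (V + 1), by positivity, ?_⟩
  intro n hn η hη Phat hPhat
  obtain ⟨hη0, hη1⟩ := hη
  have hn' : (0 : ℝ) < n := by exact_mod_cast hn
  set g := σ ⟨d - 1, by omega⟩ - σ ⟨d, hdD⟩ with hg
  set μ := Measure.pi fun _ : Fin n => ρX with hμ
  set G : (Fin n → EuclideanSpace ℝ (Fin D)) → ℝ :=
    fun ω => ∑ j, ∑ k, pcaDel n σ b j k ω ^ 2 with hG
  have hGi : Integrable G μ := integrable_finsetSum _ fun j _ => integrable_finsetSum _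
    fun k _ => (pca_var ρX hsub σ b heig j k n hn).1
  have hG0 : ∀ ω, 0 ≤ G ω := fun ω => Finset.sum_nonneg fun j _ => Finset.sum_nonneg fun k _ =>
    sq_nonneg _
  have hGint : ∫ ω, G ω ∂μ ≤ V / n := by
    rw [hG, integral_finsetSum _ fun j _ => integrable_finsetSum _
      fun k _ => (pca_var ρX hsub σ b heig j k n hn).1, hV, Finset.sum_div]
    refine Finset.sum_le_sum fun j _ => ?_
    rw [integral_finsetSum _ fun k _ => (pca_var ρX hsub σ b heig j k n hn).1, Finset.sum_div]
    exact Finset.sum_le_sum fun k _ => (pca_var ρX hsub σ b heig j k n hn).2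
  set ε := (V + 1) / (n * η) with hε
  have hε0 : 0 < ε := by positivity
  have hM := mul_meas_ge_le_integral_of_nonneg (μ := μ) (Filter.Eventually.of_forall hG0) hGi ε
  have hbad : μ {ω | ε ≤ G ω} ≤ ENNReal.ofReal η := by
    rw [← ofReal_measureReal]
    refine ENNReal.ofReal_le_ofReal ?_
    have h1 : ε * μ.real {ω | ε ≤ G ω} ≤ ε * η := by
      refine (hM.trans hGint).trans ?_
      have : ε * η = (V + 1) / n := by rw [hε]; field_simp
      rw [this]
      gcongr
      linarith
    exact le_of_mul_le_mul_left h1 hε0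
  rw [tsub_le_iff_right]
  refine le_trans ?_ (add_le_add_right hbad _)
  refine le_trans ?_ (measure_union_le _ _)
  rw [← measure_univ (μ := μ)]
  refine measure_mono fun ω _ => ?_
  by_cases hω : ε ≤ G ω
  · exact Or.inr hω
  · refine Or.inl ⟨pca_op_le _, ?_⟩
    push Not at hω
    refine (pca_det hd hdD (by omega) σ hσ b hgap n ω (Phat ω) (hPhat ω).1
      ((hPhat ω).2 _ (pcaP0_proj d hdD b))).trans ?_
    rw [← hg, ← div_div]
    refine div_le_div_of_nonneg_right ?_ hgap.le
    rw [mul_div_assoc]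
    refine mul_le_mul_of_nonneg_left ?_ (by norm_num)
    refine Real.sqrt_le_iff.2 ⟨by positivity, hω.le.trans ?_⟩
    rw [div_pow, mul_pow, Real.sq_sqrt (by positivity), Real.sq_sqrt hn'.le, hε]
    refine div_le_div_of_nonneg_left (by positivity) (by positivity) ?_
    rw [mul_comm]
    refine mul_le_mul_of_nonneg_left ?_ hn'.le
    nlinarith
end
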